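/- For every finite relational signature σ and every integer k ≥ 1 there is a constant c > 0 such that the following holds for all n ≥ 2: if 𝔄 and 𝔅 are two compatible sets of k-pebbled σ-structures, each underlying structure having at most n elements, and 𝔄 and 𝔅 disagree on some formula of ∃⁺L^k, then 𝔄 and 𝔅 disagree on some formula φ of ∃⁺L^k with quant(φ) ≤ n^{c·n^{2k−2}}. -/

import Mathlib

namespace QVT

/-- A finite relational signature: a finite type of relation symbols, each with an arity. -/
structure Signature : Type 1 where
  symbols : Type
  fin : Fintype symbols
  arity : symbols → ℕ

/-- A structure over a relational signature. -/
structure Struct (σ : Signature) : Type 1 where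
  carrier : Type
  rel : (R : σ.symbols) → (Fin (σ.arity R) → carrier) → Prop

/-- First-order formulas over the signature `σ`, with variables indexed by `ℕ`
(variable `i` represents `x_{i+1}`; variables may be reused and requantified). -/
inductive Fml (σ : Signature) : Type
  | eq : ℕ → ℕ → Fml σ
  | rel : (R : σ.symbols) → (Fin (σ.arity R) → ℕ) → Fml σ
  | not : Fml σ → Fml σ
  | and : Fml σ → Fml σ → Fml σ
  | or : Fml σ → Fml σ → Fml σ
  | ex : ℕ → Fml σ → Fml σ
  | all : ℕ → Fml σ → Fml σ

namespace Fml

variable {σ : Signature}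

/-- Satisfaction of a formula in a structure under a (total) variable assignment. -/
def Sat (M : Struct σ) : (ℕ → M.carrier) → Fml σ → Prop
  | f, .eq i j => f i = f j
  | f, .rel R v => M.rel R fun m => f (v m)
  | f, .not φ => ¬ Sat M f φ
  | f, .and φ ψ => Sat M f φ ∧ Sat M f ψ
  | f, .or φ ψ => Sat M f φ ∨ Sat M f ψ
  | f, .ex i φ => ∃ a : M.carrier, Sat M (Function.update f i a) φ
  | f, .all i φ => ∀ a : M.carrier, Sat M (Function.update f i a) φ

/-- All variables (free or bound) occurring in a formula. -/
def vars : Fml σ → Finset ℕ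
  | .eq i j => {i, j}
  | .rel _ v => Finset.univ.image v
  | .not φ => vars φ
  | .and φ ψ => vars φ ∪ vars ψ
  | .or φ ψ => vars φ ∪ vars ψ
  | .ex i φ => insert i (vars φ)
  | .all i φ => insert i (vars φ)

/-- The free variables of a formula. -/
def freeVars : Fml σ → Finset ℕ
  | .eq i j => {i, j}
  | .rel _ v => Finset.univ.image v
  | .not φ => freeVars φ
  | .and φ ψ => freeVars φ ∪ freeVars ψ
  | .or φ ψ => freeVars φ ∪ freeVars ψ
  | .ex i φ => (freeVars φ).erase i
  | .all i φ => (freeVars φ).erase i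

/-- The number of quantifier occurrences in a formula. -/
def quant : Fml σ → ℕ
  | .eq _ _ => 0
  | .rel _ _ => 0
  | .not φ => quant φ
  | .and φ ψ => quant φ + quant ψ
  | .or φ ψ => quant φ + quant ψ
  | .ex _ φ => quant φ + 1
  | .all _ φ => quant φ + 1

/-- The quantifier depth (quantifier rank) of a formula. -/
def depth : Fml σ → ℕ
  | .eq _ _ => 0
  | .rel _ _ => 0
  | .not φ => depth φ
  | .and φ ψ => max (depth φ) (depth ψ)
  | .or φ ψ => max (depth φ) (depth ψ)
  | .ex _ φ => depth φ + 1
  | .all _ φ => depth φ + 1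

/-- The size (total number of symbols) of a formula. -/
def size : Fml σ → ℕ
  | .eq _ _ => 3
  | .rel R _ => 1 + σ.arity R
  | .not φ => size φ + 1
  | .and φ ψ => size φ + size ψ + 1
  | .or φ ψ => size φ + size ψ + 1
  | .ex _ φ => size φ + 2
  | .all _ φ => size φ + 2

/-- The existential-positive formulas: built from atomic formulas using only
`∧`, `∨` and `∃`. -/
def ExPos : Fml σ → Prop
  | .eq _ _ => True
  | .rel _ _ => True
  | .not _ => False
  | .and φ ψ => ExPos φ ∧ ExPos ψ
  | .or φ ψ => ExPos φ ∧ ExPos ψ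
  | .ex _ φ => ExPos φ
  | .all _ _ => False

end Fml

/-- `φ` is a formula of `L^k`: it only uses the variables `x_1, …, x_k`
(indices `0, …, k-1`). -/
def UsesVars {σ : Signature} (k : ℕ) (φ : Fml σ) : Prop :=
  ∀ i ∈ φ.vars, i < k

/-- A sentence is a formula with no free variables. -/
def IsSentence {σ : Signature} (φ : Fml σ) : Prop := φ.freeVars = ∅

/-- Satisfaction of a sentence (assignment-independent for sentences over
nonempty structures). -/
def SatS {σ : Signature} (M : Struct σ) (φ : Fml σ) : Prop :=
  ∀ f : ℕ → M.carrier, Fml.Sat M f φ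

/-- `φ` distinguishes `A` from `B`: `A ⊨ φ` and `B ⊭ φ`. -/
def Distinguishes {σ : Signature} (A B : Struct σ) (φ : Fml σ) : Prop :=
  SatS A φ ∧ ¬ SatS B φ

/-- `A` and `B` agree on `φ`. -/
def AgreeOn {σ : Signature} (A B : Struct σ) (φ : Fml σ) : Prop :=
  SatS A φ ↔ SatS B φ

/-- A pebbled structure: a structure together with a partial assignment of the
variables to elements. -/
structure Pebbled (σ : Signature) : Type 1 where
  M : Struct σ
  α : ℕ → Option M.carrier

/-- The domain of the partial assignment of a pebbled structure. -/
def Pebbled.dom {σ : Signature} (P : Pebbled σ) : Set ℕ := {i | P.α i ≠ none}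

/-- A `k`-pebbled structure: only the variables `x_1, …, x_k` may be assigned. -/
def Pebbled.IsK {σ : Signature} (k : ℕ) (P : Pebbled σ) : Prop :=
  ∀ i, k ≤ i → P.α i = none

/-- Satisfaction for pebbled structures: `φ` holds under every total extension of
the partial assignment. -/
def PSat {σ : Signature} (P : Pebbled σ) (φ : Fml σ) : Prop :=
  ∀ f : ℕ → P.M.carrier, (∀ i a, P.α i = some a → f i = a) → Fml.Sat P.M f φ

/-- Two sets of pebbled structures disagree on `φ`: every member of `𝔄`
satisfies `φ` and no member of `𝔅` does. -/
def DisagreeOn {σ : Signature} (𝔄 𝔅 : Set (Pebbled σ)) (φ : Fml σ) : Prop :=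
  (∀ P ∈ 𝔄, PSat P φ) ∧ (∀ P ∈ 𝔅, ¬ PSat P φ)

section Helpers

variable {σ : Signature}

/-- The formula is in the k-variable existential-positive fragment, free variables in `D`. -/
def Good (k : ℕ) (D : Set ℕ) (φ : Fml σ) : Prop :=
  UsesVars k φ ∧ Fml.ExPos φ ∧ (φ.freeVars : Set ℕ) ⊆ D

theorem sat_congr (M : Struct σ) (φ : Fml σ) : ∀ (f g : ℕ → M.carrier),
    (∀ i ∈ φ.freeVars, f i = g i) → (Fml.Sat M f φ ↔ Fml.Sat M g φ) := by
  induction φ with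
  | eq i j =>
    intro f g h
    simp only [Fml.Sat]
    rw [h i (by simp [Fml.freeVars]), h j (by simp [Fml.freeVars])]
  | rel R v =>
    intro f g h
    simp only [Fml.Sat]
    have : (fun m => f (v m)) = fun m => g (v m) := by
      funext m
      exact h _ (by simp [Fml.freeVars])
    rw [this]
  | not φ ih =>
    intro f g h
    simp only [Fml.Sat]
    rw [ih f g h]
  | and φ ψ ih1 ih2 =>
    intro f g h
    simp only [Fml.Sat]
    rw [ih1 f g fun i hi => h i (by simp [Fml.freeVars, hi]),
      ih2 f g fun i hi => h i (by simp [Fml.freeVars, hi])]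
  | or φ ψ ih1 ih2 =>
    intro f g h
    simp only [Fml.Sat]
    rw [ih1 f g fun i hi => h i (by simp [Fml.freeVars, hi]),
      ih2 f g fun i hi => h i (by simp [Fml.freeVars, hi])]
  | ex i φ ih =>
    intro f g h
    simp only [Fml.Sat]
    refine exists_congr fun a => ih _ _ fun j hj => ?_
    by_cases hji : j = i
    · subst hji; simp
    · simp [Function.update_of_ne hji]
      exact h j (by simp [Fml.freeVars, hj, hji])
  | all i φ ih =>
    intro f g h
    simp only [Fml.Sat]
    refine forall_congr' fun a => ih _ _ fun j hj => ?_
    by_cases hji : j = i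
    · subst hji; simp
    · simp [Function.update_of_ne hji]
      exact h j (by simp [Fml.freeVars, hj, hji])

theorem freeVars_subset_vars (φ : Fml σ) : φ.freeVars ⊆ φ.vars := by
  induction φ with
  | eq i j => simp [Fml.freeVars, Fml.vars]
  | rel R v => simp [Fml.freeVars, Fml.vars]
  | not φ ih => simpa [Fml.freeVars, Fml.vars] using ih
  | and φ ψ ih1 ih2 => exact Finset.union_subset_union ih1 ih2
  | or φ ψ ih1 ih2 => exact Finset.union_subset_union ih1 ih2
  | ex i φ ih =>
    exact (Finset.erase_subset _ _).trans (ih.trans (Finset.subset_insert _ _))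
  | all i φ ih =>
    exact (Finset.erase_subset _ _).trans (ih.trans (Finset.subset_insert _ _))

theorem Good.and {k : ℕ} {D : Set ℕ} {φ ψ : Fml σ} (h1 : Good k D φ) (h2 : Good k D ψ) :
    Good k D (φ.and ψ) := by
  obtain ⟨a1, b1, c1⟩ := h1
  obtain ⟨a2, b2, c2⟩ := h2
  refine ⟨?_, ⟨b1, b2⟩, ?_⟩
  · intro i hi
    simp only [Fml.vars, Finset.mem_union] at hi
    exact hi.elim (a1 i) (a2 i)
  · simp only [Fml.freeVars, Finset.coe_union]
    exact Set.union_subset c1 c2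

theorem Good.or {k : ℕ} {D : Set ℕ} {φ ψ : Fml σ} (h1 : Good k D φ) (h2 : Good k D ψ) :
    Good k D (φ.or ψ) := Good.and (σ := σ) h1 h2

theorem Good.ex {k : ℕ} {D : Set ℕ} {φ : Fml σ} {i : ℕ} (hi : i < k)
    (h : Good k (insert i D) φ) : Good k D (φ.ex i) := by
  obtain ⟨a, b, c⟩ := h
  refine ⟨?_, b, ?_⟩
  · intro j hj
    simp only [Fml.vars, Finset.mem_insert] at hj
    rcases hj with rfl | hj
    · exact hi
    · exact a j hj
  · intro j hj
    simp only [Fml.freeVars, Finset.coe_erase, Set.mem_sdiff, Set.mem_singleton_iff] at hj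
    exact (c hj.1).resolve_left hj.2

theorem good_true {k : ℕ} (hk : 1 ≤ k) (D : Set ℕ) :
    Good (σ := σ) k D (.ex 0 (.eq 0 0)) := by
  refine Good.ex hk ⟨?_, trivial, ?_⟩
  · intro i hi
    simp [Fml.vars] at hi
    omega
  · simp [Fml.freeVars]

theorem bigAnd {k : ℕ} {D : Set ℕ} {ι : Type} (s : Finset ι) (F : ι → Fml σ) (base : Fml σ)
    (X : ℕ) (hb : Good k D base) (hF : ∀ i, Good k D (F i)) (hX : ∀ i, (F i).quant ≤ X) :
    ∃ φ : Fml σ, Good k D φ ∧ φ.quant ≤ base.quant + s.card * X ∧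
      ∀ (M : Struct σ) (f : ℕ → M.carrier),
        Fml.Sat M f φ ↔ (Fml.Sat M f base ∧ ∀ i ∈ s, Fml.Sat M f (F i)) := by
  classical
  induction s using Finset.induction_on with
  | empty => exact ⟨base, hb, by simp, by simp⟩
  | insert a s ha ih =>
    obtain ⟨φ, h1, h2, h3⟩ := ih
    refine ⟨φ.and (F a), h1.and (hF a), ?_, ?_⟩
    · rw [Finset.card_insert_of_notMem ha]
      simp only [Fml.quant]
      have := hX a
      nlinarith
    · intro M f
      simp only [Fml.Sat, h3, Finset.forall_mem_insert]
      tauto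

theorem bigOr {k : ℕ} {D : Set ℕ} {ι : Type} (s : Finset ι) (F : ι → Fml σ) (base : Fml σ)
    (X : ℕ) (hb : Good k D base) (hF : ∀ i, Good k D (F i)) (hX : ∀ i, (F i).quant ≤ X) :
    ∃ φ : Fml σ, Good k D φ ∧ φ.quant ≤ base.quant + s.card * X ∧
      ∀ (M : Struct σ) (f : ℕ → M.carrier),
        Fml.Sat M f φ ↔ (Fml.Sat M f base ∨ ∃ i ∈ s, Fml.Sat M f (F i)) := by
  classical
  induction s using Finset.induction_on with
  | empty => exact ⟨base, hb, by simp, by simp⟩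
  | insert a s ha ih =>
    obtain ⟨φ, h1, h2, h3⟩ := ih
    refine ⟨φ.or (F a), h1.or (hF a), ?_, ?_⟩
    · rw [Finset.card_insert_of_notMem ha]
      simp only [Fml.quant]
      have := hX a
      nlinarith
    · intro M f
      simp only [Fml.Sat, h3, Finset.exists_mem_insert]
      rw [or_assoc, or_comm (b := Fml.Sat M f (F a))]

/-- Separation by a quantifier-free formula. -/
def W0 (k : ℕ) (A B : Struct σ) (D : Set ℕ) (f : ℕ → A.carrier) (g : ℕ → B.carrier) : Prop :=
  ∃ φ : Fml σ, Good k D φ ∧ φ.quant = 0 ∧ Fml.Sat A f φ ∧ ¬ Fml.Sat B g φ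

/-- Spoiler wins the existential k-pebble game in at most `d` rounds. -/
def W (k : ℕ) (A B : Struct σ) :
    ℕ → Set ℕ → (ℕ → A.carrier) → (ℕ → B.carrier) → Prop
  | 0, D, f, g => W0 k A B D f g
  | d + 1, D, f, g => W0 k A B D f g ∨ ∃ i < k, ∃ a, ∀ b,
      W k A B d (insert i D) (Function.update f i a) (Function.update g i b)

theorem W_zero_le {k : ℕ} {A B : Struct σ} {d : ℕ} {D : Set ℕ} {f : ℕ → A.carrier}
    {g : ℕ → B.carrier} (h : W0 k A B D f g) : W k A B d D f g := by
  cases d with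
  | zero => exact h
  | succ d => exact Or.inl h

theorem W_succ {k : ℕ} {A B : Struct σ} (d : ℕ) : ∀ {D : Set ℕ} {f : ℕ → A.carrier}
    {g : ℕ → B.carrier}, W k A B d D f g → W k A B (d + 1) D f g := by
  induction d with
  | zero => intro D f g h; exact Or.inl h
  | succ d ih =>
    intro D f g h
    rcases h with h | ⟨i, hi, a, h⟩
    · exact Or.inl h
    · exact Or.inr ⟨i, hi, a, fun b => ih (h b)⟩

theorem W_mono {k : ℕ} {A B : Struct σ} {d e : ℕ} (hde : d ≤ e) {D : Set ℕ}
    {f : ℕ → A.carrier} {g : ℕ → B.carrier} (h : W k A B d D f g) : W k A B e D f g := by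
  induction e, hde using Nat.le_induction with
  | base => exact h
  | succ e _ ih => exact W_succ e ih

theorem W_congr {k : ℕ} {A B : Struct σ} (d : ℕ) : ∀ {D D' : Set ℕ} {f f' : ℕ → A.carrier}
    {g g' : ℕ → B.carrier}, (∀ j < k, j ∈ D → j ∈ D' ∧ f j = f' j ∧ g j = g' j) →
    W k A B d D f g → W k A B d D' f' g' := by
  have key : ∀ {D D' : Set ℕ} {f f' : ℕ → A.carrier}
    {g g' : ℕ → B.carrier}, (∀ j < k, j ∈ D → j ∈ D' ∧ f j = f' j ∧ g j = g' j) →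
    W0 k A B D f g → W0 k A B D' f' g' := by
    rintro D D' f f' g g' h ⟨φ, ⟨h1, h2, h3⟩, h4, h5, h6⟩
    have hlt : ∀ j ∈ φ.freeVars, j < k := fun j hj => h1 j (freeVars_subset_vars φ hj)
    refine ⟨φ, ⟨h1, h2, fun j hj => (h j (hlt j hj) (h3 hj)).1⟩, h4, ?_, ?_⟩
    · rwa [← sat_congr A φ f f' fun j hj => (h j (hlt j hj) (h3 hj)).2.1]
    · rwa [← sat_congr B φ g g' fun j hj => (h j (hlt j hj) (h3 hj)).2.2]
  induction d with
  | zero => intro D D' f f' g g' h hw; exact key h hw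
  | succ d ih =>
    intro D D' f f' g g' h hw
    rcases hw with hw | ⟨i, hi, a, hw⟩
    · exact Or.inl (key h hw)
    · refine Or.inr ⟨i, hi, a, fun b => ih ?_ (hw b)⟩
      intro j hj hjD
      by_cases hji : j = i
      · subst hji; simp
      · have hjD' := (Set.mem_insert_iff.mp hjD).resolve_left hji
        simp only [Function.update_of_ne hji]
        exact ⟨Or.inr (h j hj hjD').1, (h j hj hjD').2⟩

theorem W_complete {k : ℕ} {A B : Struct σ} [Finite B.carrier] (φ : Fml σ) :
    ∀ {D : Set ℕ} {f : ℕ → A.carrier} {g : ℕ → B.carrier}, Good k D φ →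
    Fml.Sat A f φ → ¬ Fml.Sat B g φ → ∃ d, W k A B d D f g := by
  induction φ with
  | eq i j => intro D f g h h1 h2; exact ⟨0, _, h, rfl, h1, h2⟩
  | rel R v => intro D f g h h1 h2; exact ⟨0, _, h, rfl, h1, h2⟩
  | not φ ih => intro D f g h; exact h.2.1.elim
  | all i φ ih => intro D f g h; exact h.2.1.elim
  | and φ ψ ih1 ih2 =>
    rintro D f g ⟨h1, h2, h3⟩ hA hB
    simp only [Fml.freeVars, Finset.coe_union, Set.union_subset_iff] at h3
    have g1 : Good k D φ := ⟨fun i hi => h1 i (by simp [Fml.vars, hi]), h2.1, h3.1⟩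
    have g2 : Good k D ψ := ⟨fun i hi => h1 i (by simp [Fml.vars, hi]), h2.2, h3.2⟩
    simp only [Fml.Sat, not_and_or] at hA hB
    rcases hB with hB | hB
    · exact ih1 g1 hA.1 hB
    · exact ih2 g2 hA.2 hB
  | or φ ψ ih1 ih2 =>
    rintro D f g ⟨h1, h2, h3⟩ hA hB
    simp only [Fml.freeVars, Finset.coe_union, Set.union_subset_iff] at h3
    have g1 : Good k D φ := ⟨fun i hi => h1 i (by simp [Fml.vars, hi]), h2.1, h3.1⟩
    have g2 : Good k D ψ := ⟨fun i hi => h1 i (by simp [Fml.vars, hi]), h2.2, h3.2⟩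
    simp only [Fml.Sat, not_or] at hA hB
    rcases hA with hA | hA
    · exact ih1 g1 hA hB.1
    · exact ih2 g2 hA hB.2
  | ex i φ ih =>
    rintro D f g ⟨h1, h2, h3⟩ hA hB
    have g1 : Good k (insert i D) φ := by
      refine ⟨fun j hj => h1 j (by simp [Fml.vars, hj]), h2, fun j hj => ?_⟩
      by_cases hji : j = i
      · exact Or.inl hji
      · exact Or.inr (h3 (by simp [Fml.freeVars, hji]; exact hj))
    simp only [Fml.Sat, not_exists] at hA hB
    obtain ⟨a, ha⟩ := hA
    choose d hd using fun b => ih g1 ha (hB b)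
    obtain ⟨m, hm⟩ := (Set.finite_range d).bddAbove
    refine ⟨m + 1, Or.inr ⟨i, h1 i (by simp [Fml.vars]), a, fun b => ?_⟩⟩
    exact W_mono (hm ⟨b, rfl⟩) (hd b)

theorem W_sound {k n : ℕ} (hn : 2 ≤ n) {A B : Struct σ} [Finite B.carrier]
    (hB : Nat.card B.carrier ≤ n) (d : ℕ) :
    ∀ {D : Set ℕ} {f : ℕ → A.carrier} {g : ℕ → B.carrier}, W k A B d D f g →
    ∃ φ : Fml σ, Good k D φ ∧ φ.quant + 1 ≤ n ^ d ∧ Fml.Sat A f φ ∧ ¬ Fml.Sat B g φ := by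
  have key : ∀ d, ∀ {D : Set ℕ} {f : ℕ → A.carrier} {g : ℕ → B.carrier}, W0 k A B D f g →
    ∃ φ : Fml σ, Good k D φ ∧ φ.quant + 1 ≤ n ^ d ∧ Fml.Sat A f φ ∧ ¬ Fml.Sat B g φ := by
    rintro d D f g ⟨φ, h1, h2, h3⟩
    refine ⟨φ, h1, ?_, h3⟩
    rw [h2]
    exact Nat.one_le_pow _ _ (by omega)
  induction d with
  | zero => intro D f g h; exact key 0 h
  | succ d ih =>
    intro D f g h
    rcases h with h | ⟨i, hi, a, h⟩
    · exact key _ h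
    · choose F hF1 hF2 hF3 hF4 using fun b => ih (h b)
      have : Fintype B.carrier := Fintype.ofFinite _
      have hbase : Good (σ := σ) k (insert i D) (.eq i i) := by
        refine ⟨?_, trivial, ?_⟩
        · intro j hj
          simp [Fml.vars] at hj
          omega
        · simp [Fml.freeVars]
      obtain ⟨φ, g1, g2, g3⟩ := bigAnd Finset.univ F (.eq i i) (n ^ d - 1) hbase hF1
        (fun b => by have := hF2 b; omega)
      refine ⟨φ.ex i, g1.ex hi, ?_, ?_, ?_⟩
      · simp only [Fml.quant, zero_add] at g2 ⊢
        rw [Finset.card_univ, ← Nat.card_eq_fintype_card] at g2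
        have h1 : 1 ≤ n ^ d := Nat.one_le_pow _ _ (by omega)
        obtain ⟨X, hX⟩ := Nat.exists_eq_add_of_le' h1
        rw [pow_succ, hX]
        rw [hX, Nat.add_sub_cancel] at g2
        nlinarith [Nat.mul_le_mul_right X hB]
      · exact ⟨a, (g3 _ _).2 ⟨rfl, fun b _ => hF3 b⟩⟩
      · rintro ⟨b, hb⟩
        exact hF4 b (((g3 _ _).1 hb).2 b (Finset.mem_univ _))

open Classical in
/-- Encoding of a position after picking up pebble `i`. -/
noncomputable def enc {k : ℕ} {A B : Struct σ} (i : Fin k) (D : Set ℕ) (f : ℕ → A.carrier)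
    (g : ℕ → B.carrier) : Σ i : Fin k, ({j : Fin k // j ≠ i} → Option (A.carrier × B.carrier)) :=
  ⟨i, fun j => if (j.1 : ℕ) ∈ D then some (f j.1, g j.1) else none⟩

/-- Spoiler wins by placing pebble `i`. -/
def V (k : ℕ) (A B : Struct σ) (d : ℕ) (i : ℕ) (D : Set ℕ) (f : ℕ → A.carrier)
    (g : ℕ → B.carrier) : Prop :=
  ∃ a, ∀ b, W k A B d (insert i D) (Function.update f i a) (Function.update g i b)

/-- Winning positions. -/
def U (k : ℕ) (A B : Struct σ) (d : ℕ) :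
    Set (Σ i : Fin k, ({j : Fin k // j ≠ i} → Option (A.carrier × B.carrier))) :=
  {p | ∃ i D f g, enc i D f g = p ∧ V k A B d i D f g}

theorem mem_U {k : ℕ} {A B : Struct σ} {d : ℕ} (i : Fin k) (D : Set ℕ) (f : ℕ → A.carrier)
    (g : ℕ → B.carrier) : enc i D f g ∈ U k A B d ↔ V k A B d i D f g := by
  constructor
  · rintro ⟨i', D', f', g', he, a, hV⟩
    have hi : i' = i := congrArg Sigma.fst he
    subst hi
    refine ⟨a, fun b => W_congr d ?_ (hV b)⟩
    intro j hj hjD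
    by_cases hji : j = i'
    · subst hji; simp
    · have hjD' := (Set.mem_insert_iff.mp hjD).resolve_left hji
      have h2 := eq_of_heq (Sigma.mk.inj he).2
      have h3 := congrFun h2 ⟨⟨j, hj⟩, fun h => hji (congrArg Fin.val h)⟩
      simp only [hjD', if_true] at h3
      split_ifs at h3 with h4
      simp only [Option.some.injEq, Prod.mk.injEq] at h3
      simp only [Function.update_of_ne hji]
      exact ⟨Or.inr h4, h3⟩
  · intro h
    exact ⟨i, D, f, g, rfl, h⟩

theorem U_mono {k : ℕ} {A B : Struct σ} : Monotone (U k A B) := by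
  rintro d e hde p ⟨i, D, f, g, h, a, hV⟩
  exact ⟨i, D, f, g, h, a, fun b => W_mono hde (hV b)⟩

theorem W_of_U {k : ℕ} {A B : Struct σ} {d e : ℕ} (h : U k A B d ⊆ U k A B e) {D : Set ℕ}
    {f : ℕ → A.carrier} {g : ℕ → B.carrier} (hw : W k A B (d + 1) D f g) :
    W k A B (e + 1) D f g := by
  rcases hw with hw | ⟨i, hi, hw⟩
  · exact Or.inl hw
  · exact Or.inr ⟨i, hi, (mem_U ⟨i, hi⟩ D f g).1 (h ((mem_U ⟨i, hi⟩ D f g).2 hw))⟩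

theorem U_stab {k : ℕ} {A B : Struct σ} [Finite A.carrier] [Finite B.carrier] {C : ℕ}
    (hC : Nat.card (Σ i : Fin k, ({j : Fin k // j ≠ i} → Option (A.carrier × B.carrier))) ≤ C)
    (d : ℕ) : U k A B d ⊆ U k A B C := by
  rcases le_total d C with h | h
  · exact U_mono h
  · have hfin : ∀ s : Set (Σ i : Fin k, ({j : Fin k // j ≠ i} →
        Option (A.carrier × B.carrier))), s.Finite := fun s => s.toFinite
    have := Nat.stabilises_of_monotone (f := fun d => (U k A B d).ncard) (b := C) (n := d)
      (fun d e hde => Set.ncard_le_ncard (U_mono hde) (hfin _))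
      (fun m => (Set.ncard_le_card _).trans hC)
      (by
        intro m hm
        have he : U k A B m = U k A B (m + 1) :=
          Set.eq_of_subset_of_ncard_le (U_mono (Nat.le_succ m)) hm.ge (hfin _)
        have he2 : U k A B (m + 1) = U k A B (m + 2) := by
          refine Set.Subset.antisymm (U_mono (Nat.le_succ _)) ?_
          rintro p ⟨i, D, f, g, h, a, hV⟩
          exact ⟨i, D, f, g, h, a, fun b => W_of_U he.ge (hV b)⟩
        exact congrArg Set.ncard he2) h
    exact (Set.eq_of_subset_of_ncard_le (U_mono h) this.le (hfin _)).ge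

theorem card_pos_le {k n : ℕ} (hn : 2 ≤ n) {A B : Type} [Finite A] [Finite B]
    (hA : Nat.card A ≤ n) (hB : Nat.card B ≤ n) :
    Nat.card (Σ i : Fin k, ({j : Fin k // j ≠ i} → Option (A × B))) ≤
      k * 2 ^ (k - 1) * n ^ (2 * k - 2) := by
  classical
  have := Fintype.ofFinite A
  have := Fintype.ofFinite B
  rw [Nat.card_eq_fintype_card] at hA hB ⊢
  have h1 : Fintype.card A * Fintype.card B + 1 ≤ 2 * n ^ 2 := by
    nlinarith [Nat.mul_le_mul hA hB]
  simp only [Fintype.card_sigma, Fintype.card_fun, Fintype.card_option, Fintype.card_prod,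
    Fintype.card_subtype_compl, Fintype.card_fin, Fintype.card_subtype_eq, Finset.sum_const,
    Finset.card_univ, smul_eq_mul]
  rw [mul_assoc]
  refine Nat.mul_le_mul_left _ ?_
  calc _ ≤ (2 * n ^ 2) ^ (k - 1) := Nat.pow_le_pow_left h1 _
    _ = _ := by
      rw [mul_pow, ← pow_mul]
      congr 2
      omega

/-- Separating a single pair. -/
theorem pair_sep {k n : ℕ} (hn : 2 ≤ n) {A B : Struct σ} [Finite A.carrier] [Finite B.carrier]
    (hA : Nat.card A.carrier ≤ n) (hB : Nat.card B.carrier ≤ n) {D : Set ℕ}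
    {f : ℕ → A.carrier} {g : ℕ → B.carrier} {φ₀ : Fml σ} (h0 : Good k D φ₀)
    (h1 : Fml.Sat A f φ₀) (h2 : ¬ Fml.Sat B g φ₀) :
    ∃ φ : Fml σ, Good k D φ ∧ φ.quant ≤ n ^ (k * 2 ^ (k - 1) * n ^ (2 * k - 2) + 1) ∧
      Fml.Sat A f φ ∧ ¬ Fml.Sat B g φ := by
  obtain ⟨d, hd⟩ := W_complete φ₀ h0 h1 h2
  obtain ⟨φ, g1, g2, g3⟩ := W_sound hn hB _
    (W_of_U (U_stab (card_pos_le hn hA hB) d) (W_succ d hd))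
  exact ⟨φ, g1, by omega, g3⟩

/-- A structure with a total assignment. -/
abbrev Pt (σ : Signature) : Type 1 := Σ M : Struct σ, ℕ → M.carrier

/-- Relational atoms in k variables. -/
abbrev At (σ : Signature) (k : ℕ) : Type := Σ R : σ.symbols, (Fin (σ.arity R) → Fin k)

/-- Finite invariants. -/
abbrev Key (σ : Signature) (k : ℕ) (T : Type) : Type :=
  Set T × (Fin k → T) × Set ((Fin k → T) × At σ k)

/-- The invariant of a structure with assignment, relative to a labelling. -/
def key (k : ℕ) {T : Type} (p : Pt σ) (h : p.1.carrier → T) : Key σ k T :=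
  (Set.range h, fun i => h (p.2 i),
    {q | ∃ a : Fin k → p.1.carrier, (fun i => h (a i)) = q.1 ∧
      p.1.rel q.2.1 fun m => a (q.2.2 m)})

/-- The labelling determines atoms. -/
def Lab (k : ℕ) {T : Type} (M : Struct σ) (h : M.carrier → T) : Prop :=
  (∀ (a a' : Fin k → M.carrier), (∀ i, h (a i) = h (a' i)) → ∀ q : At σ k,
    (M.rel q.1 fun m => a (q.2 m)) → M.rel q.1 fun m => a' (q.2 m)) ∧
  (∀ (a : Fin k → M.carrier) i j, h (a i) = h (a j) → a i = a j)

theorem key_sat {k : ℕ} {T : Type} {p p' : Pt σ} {h : p.1.carrier → T}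
    {h' : p'.1.carrier → T} (hl' : Lab k p'.1 h') (he : key k p h = key k p' h') (φ : Fml σ)
    (hv : UsesVars k φ) (hp : Fml.ExPos φ) (hs : Fml.Sat p.1 p.2 φ) :
    Fml.Sat p'.1 p'.2 φ := by
  simp only [key, Prod.mk.injEq] at he
  obtain ⟨he1, he2, he3⟩ := he
  have main : ∀ φ : Fml σ, UsesVars k φ → Fml.ExPos φ → ∀ g g',
      (∀ i < k, h (g i) = h' (g' i)) → Fml.Sat p.1 g φ → Fml.Sat p'.1 g' φ := by
    clear hs hp hv φ
    intro φ
    induction φ with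
    | eq i j =>
      intro hv _ g g' hg hs
      have hi : i < k := hv i (by simp [Fml.vars])
      have hj : j < k := hv j (by simp [Fml.vars])
      refine hl'.2 (fun i => g' i) ⟨i, hi⟩ ⟨j, hj⟩ ?_
      simp only [Fml.Sat] at hs
      simp only
      rw [← hg i hi, ← hg j hj, hs]
    | rel R v =>
      intro hv _ g g' hg hs
      have hlt : ∀ m, v m < k := fun m => hv _ (by simp [Fml.vars])
      have hmem : ((fun i : Fin k => h (g i)),
          (⟨R, fun m => ⟨v m, hlt m⟩⟩ : At σ k)) ∈ {q : (Fin k → T) × At σ k |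
          ∃ a : Fin k → p.1.carrier, (fun i => h (a i)) = q.1 ∧
          p.1.rel q.2.1 fun m => a (q.2.2 m)} := ⟨fun i => g i, rfl, hs⟩
      rw [he3] at hmem
      obtain ⟨a, ha, hr⟩ := hmem
      exact hl'.1 a (fun i => g' i) (fun i => (congrFun ha i).trans (hg i i.2)) _ hr
    | not φ ih => intro _ hp; exact hp.elim
    | all i φ ih => intro _ hp; exact hp.elim
    | and φ ψ ih1 ih2 =>
      intro hv hp g g' hg hs
      exact ⟨ih1 (fun i hi => hv i (by simp [Fml.vars, hi])) hp.1 g g' hg hs.1,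
        ih2 (fun i hi => hv i (by simp [Fml.vars, hi])) hp.2 g g' hg hs.2⟩
    | or φ ψ ih1 ih2 =>
      intro hv hp g g' hg hs
      exact hs.imp (ih1 (fun i hi => hv i (by simp [Fml.vars, hi])) hp.1 g g' hg)
        (ih2 (fun i hi => hv i (by simp [Fml.vars, hi])) hp.2 g g' hg)
    | ex i φ ih =>
      intro hv hp g g' hg hs
      obtain ⟨a, ha⟩ := hs
      obtain ⟨a', ha'⟩ : h a ∈ Set.range h' := he1 ▸ ⟨a, rfl⟩
      refine ⟨a', ih (fun i hi => hv i (by simp [Fml.vars, hi])) hp _ _ ?_ ha⟩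
      intro j hj
      by_cases hji : j = i
      · subst hji; simp [ha']
      · simp only [Function.update_of_ne hji]
        exact hg j hj
  exact main φ hv hp _ _ (fun i hi => congrFun he2 ⟨i, hi⟩) hs

/-- Combination of the pairwise formulas. -/
theorem core {k n N : ℕ} (hk : 1 ≤ k) (hn : 2 ≤ n) (𝔸 𝔹 : Set (Pt σ)) (D : Set ℕ)
    (hne : 𝔸.Nonempty)
    (hcard : ∀ p ∈ 𝔸 ∪ 𝔹, Finite p.1.carrier ∧ Nat.card p.1.carrier ≤ n)
    {T : Type} [Finite (Key σ k T)] (hN : Nat.card (Key σ k T) = N)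
    (hT : ∀ p ∈ 𝔸 ∪ 𝔹, ∃ h : p.1.carrier → T, Lab k p.1 h)
    (φ₀ : Fml σ) (h0 : Good k D φ₀) (hA : ∀ p ∈ 𝔸, Fml.Sat p.1 p.2 φ₀)
    (hB : ∀ p ∈ 𝔹, ¬ Fml.Sat p.1 p.2 φ₀) :
    ∃ φ : Fml σ, Good k D φ ∧
      φ.quant ≤ (N + 1) ^ 2 * n ^ (k * 2 ^ (k - 1) * n ^ (2 * k - 2) + 1) ∧
      (∀ p ∈ 𝔸, Fml.Sat p.1 p.2 φ) ∧ (∀ p ∈ 𝔹, ¬ Fml.Sat p.1 p.2 φ) := by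
  classical
  have : Fintype (Key σ k T) := Fintype.ofFinite _
  rw [Nat.card_eq_fintype_card] at hN
  set X := n ^ (k * 2 ^ (k - 1) * n ^ (2 * k - 2) + 1) with hX
  have hX1 : 1 ≤ X := Nat.one_le_pow _ _ (by omega)
  have hT' : ∀ p : Pt σ, ∃ κ : Key σ k T, p ∈ 𝔸 ∪ 𝔹 →
      ∃ h : p.1.carrier → T, Lab k p.1 h ∧ key k p h = κ := by
    intro p
    by_cases hp : p ∈ 𝔸 ∪ 𝔹
    · obtain ⟨h, hh⟩ := hT p hp
      exact ⟨_, fun _ => ⟨h, hh, rfl⟩⟩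
    · obtain ⟨p0, hp0⟩ := hne
      obtain ⟨h, hh⟩ := hT p0 (Or.inl hp0)
      exact ⟨key k p0 h, fun h => (hp h).elim⟩
  choose κ hκ using hT'
  have inv : ∀ p ∈ 𝔸 ∪ 𝔹, ∀ p' ∈ 𝔸 ∪ 𝔹, κ p = κ p' → ∀ φ : Fml σ, Good k D φ →
      Fml.Sat p.1 p.2 φ → Fml.Sat p'.1 p'.2 φ := by
    intro p hp p' hp' he φ hφ hs
    obtain ⟨h, _, e1⟩ := hκ p hp
    obtain ⟨h', l2, e2⟩ := hκ p' hp'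
    exact key_sat l2 (e1.trans (he.trans e2.symm)) φ hφ.1 hφ.2.1 hs
  -- one structure on the left
  have step1 : ∀ p ∈ 𝔸, ∃ ψ : Fml σ, Good k D ψ ∧ ψ.quant ≤ 1 + N * X ∧
      Fml.Sat p.1 p.2 ψ ∧ ∀ q ∈ 𝔹, ¬ Fml.Sat q.1 q.2 ψ := by
    intro p hp
    have hb : ∀ b : Key σ k T, ∃ φ : Fml σ, Good k D φ ∧ φ.quant ≤ X ∧ Fml.Sat p.1 p.2 φ ∧
        ∀ q ∈ 𝔹, κ q = b → ¬ Fml.Sat q.1 q.2 φ := by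
      intro b
      by_cases hb : ∃ q ∈ 𝔹, κ q = b
      · obtain ⟨q, hq, rfl⟩ := hb
        obtain ⟨f1, c1⟩ := hcard p (Or.inl hp)
        obtain ⟨f2, c2⟩ := hcard q (Or.inr hq)
        obtain ⟨φ, g1, g2, g3, g4⟩ := pair_sep hn c1 c2 h0 (hA p hp) (hB q hq)
        exact ⟨φ, g1, g2, g3, fun q' hq' he hs =>
          g4 (inv q' (Or.inr hq') q (Or.inr hq) he φ g1 hs)⟩
      · push Not at hb
        exact ⟨_, good_true hk D, by simpa [Fml.quant] using hX1, ⟨p.2 0, rfl⟩,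
          fun q hq he => (hb q hq he).elim⟩
    choose F F1 F2 F3 F4 using hb
    obtain ⟨ψ, g1, g2, g3⟩ := bigAnd Finset.univ F _ X (good_true hk D) F1 F2
    refine ⟨ψ, g1, ?_, ?_, ?_⟩
    · rw [Finset.card_univ, hN] at g2
      simpa [Fml.quant] using g2
    · exact (g3 _ _).2 ⟨⟨p.2 0, rfl⟩, fun b _ => F3 b⟩
    · intro q hq hs
      exact F4 (κ q) q hq rfl (((g3 _ _).1 hs).2 _ (Finset.mem_univ _))
  obtain ⟨p0, hp0⟩ := hne
  obtain ⟨ψ0, a1, a2, a3, a4⟩ := step1 p0 hp0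
  have step2 : ∀ a : Key σ k T, ∃ ψ : Fml σ, Good k D ψ ∧ ψ.quant ≤ 1 + N * X ∧
      (∀ p ∈ 𝔸, κ p = a → Fml.Sat p.1 p.2 ψ) ∧ ∀ q ∈ 𝔹, ¬ Fml.Sat q.1 q.2 ψ := by
    intro a
    by_cases ha : ∃ p ∈ 𝔸, κ p = a
    · obtain ⟨p, hp, rfl⟩ := ha
      obtain ⟨ψ, b1, b2, b3, b4⟩ := step1 p hp
      exact ⟨ψ, b1, b2, fun p' hp' he => inv p (Or.inl hp) p' (Or.inl hp') he.symm ψ b1 b3, b4⟩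
    · push Not at ha
      exact ⟨ψ0, a1, a2, fun p hp he => (ha p hp he).elim, a4⟩
  choose F F1 F2 F3 F4 using step2
  obtain ⟨ψ, g1, g2, g3⟩ := bigOr Finset.univ F ψ0 _ a1 F1 F2
  refine ⟨ψ, g1, ?_, ?_, ?_⟩
  · rw [Finset.card_univ, hN] at g2
    calc ψ.quant ≤ (1 + N * X) + N * (1 + N * X) := g2.trans (by omega)
      _ = (N + 1) * (1 + N * X) := by ring
      _ ≤ (N + 1) * ((N + 1) * X) := Nat.mul_le_mul_left _ (by nlinarith)
      _ = _ := by ring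
  · intro p hp
    exact (g3 _ _).2 (Or.inr ⟨κ p, Finset.mem_univ _, F3 _ p hp rfl⟩)
  · intro q hq hs
    rcases (g3 _ _).1 hs with hs | ⟨a, _, hs⟩
    · exact a4 q hq hs
    · exact F4 a q hq hs

/-- The full one-element structure. -/
def fullS (σ : Signature) : Struct σ := ⟨Unit, fun _ _ => True⟩

theorem full_sat (φ : Fml σ) (hp : Fml.ExPos φ) : ∀ f, Fml.Sat (fullS σ) f φ := by
  induction φ with
  | eq i j => intro f; rfl
  | rel R v => intro f; trivial
  | not φ ih => exact hp.elim
  | all i φ ih => exact hp.elim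
  | and φ ψ ih1 ih2 => exact fun f => ⟨ih1 hp.1 f, ih2 hp.2 f⟩
  | or φ ψ ih1 ih2 => exact fun f => Or.inl (ih1 hp.1 f)
  | ex i φ ih => exact fun f => ⟨(), ih hp _⟩

theorem card_key (k : ℕ) (T : Type) [Finite T] :
    Finite (Key σ k T) ∧ Nat.card (Key σ k T) =
      2 ^ Nat.card T * (Nat.card T ^ k * 2 ^ (Nat.card T ^ k * Nat.card (At σ k))) := by
  classical
  have := σ.fin
  have := Fintype.ofFinite T
  refine ⟨inferInstance, ?_⟩
  simp only [Nat.card_eq_fintype_card, Fintype.card_prod, Fintype.card_set, Fintype.card_fun,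
    Fintype.card_fin]

theorem lab_exists (σ : Signature) (k : ℕ) (hk : 1 ≤ k) : ∃ e : ℕ, ∀ n : ℕ, 2 ≤ n →
    ∃ (T : Type) (N : ℕ), Finite (Key σ k T) ∧ Nat.card (Key σ k T) = N ∧
      N + 1 ≤ n ^ (e * n ^ (2 * k - 2)) ∧
      ∀ M : Struct σ, Finite M.carrier → Nat.card M.carrier ≤ n →
        ∃ h : M.carrier → T, Lab k M h := by
  classical
  have := σ.fin
  rcases hk.eq_or_lt with rfl | hk2
  · obtain ⟨hf, hc⟩ := card_key (σ := σ) 1 (Set (At σ 1))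
    refine ⟨Nat.card (Key σ 1 (Set (At σ 1))), fun n hn =>
      ⟨Set (At σ 1), _, hf, rfl, ?_, ?_⟩⟩
    · simp only [mul_one, Nat.sub_self, pow_zero]
      exact (Nat.lt_two_pow_self).trans_le (Nat.pow_le_pow_left hn _)
    · intro M _ _
      refine ⟨fun a => {q | M.rel q.1 fun m => a}, ?_, ?_⟩
      · intro a a' h q hq
        have h0 := h 0
        beta_reduce at h0
        have hq' : q ∈ {q : At σ 1 | M.rel q.1 fun m => a 0} := by
          have : (fun m => a (q.2 m)) = fun _ => a 0 := by
            funext m; rw [Subsingleton.elim (q.2 m) 0]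
          rw [this] at hq
          exact hq
        rw [h0] at hq'
        have : (fun m => a' (q.2 m)) = fun _ => a' 0 := by
          funext m; rw [Subsingleton.elim (q.2 m) 0]
        rw [this]
        exact hq'
      · intro a i j _
        rw [Subsingleton.elim i j]
  · refine ⟨2 + k + Nat.card (At σ k), fun n hn => ?_⟩
    obtain ⟨hf, hc⟩ := card_key (σ := σ) k (Fin n)
    refine ⟨Fin n, _, hf, rfl, ?_, ?_⟩
    · rw [hc, Nat.card_fin]
      set K := Nat.card (At σ k)
      set m := n ^ (2 * k - 2) with hm
      have e1 : n ≤ m := Nat.le_self_pow (by omega) n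
      have e2 : n ^ k ≤ m := Nat.pow_le_pow_right (by omega) (by omega)
      have p2 : ∀ a, 2 ^ a ≤ n ^ a := fun a => Nat.pow_le_pow_left hn a
      have l : 2 ^ n * (n ^ k * 2 ^ (n ^ k * K)) ≤ n ^ (m + (k * m + m * K)) := by
        rw [pow_add, pow_add]
        refine Nat.mul_le_mul ((p2 n).trans (Nat.pow_le_pow_right (by omega) e1))
          (Nat.mul_le_mul (Nat.pow_le_pow_right (by omega) (by nlinarith)) ?_)
        exact (p2 _).trans (Nat.pow_le_pow_right (by omega) (Nat.mul_le_mul_right _ e2))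
      have l1 : 1 ≤ n ^ (m + (k * m + m * K)) := Nat.one_le_pow _ _ (by omega)
      calc _ ≤ n ^ (m + (k * m + m * K)) * n := by nlinarith
        _ = n ^ (m + (k * m + m * K) + 1) := (pow_succ _ _).symm
        _ ≤ _ := Nat.pow_le_pow_right (by omega) (by nlinarith)
    · intro M hM hMc
      have := Fintype.ofFinite M.carrier
      rw [Nat.card_eq_fintype_card] at hMc
      obtain ⟨h⟩ : Nonempty (M.carrier ↪ Fin n) :=
        Function.Embedding.nonempty_of_card_le (by simpa using hMc)
      refine ⟨h, ?_, ?_⟩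
      · intro a a' ha q hq
        have : a = a' := funext fun i => h.injective (ha i)
        exact this ▸ hq
      · intro a i j hij
        exact h.injective hij

end Helpers

/-- Lemma 13 of the paper. For every finite relational signature `σ`
and `k ≥ 1` there is `c > 0` such that for all `n ≥ 2`: any two compatible sets of
`k`-pebbled `σ`-structures with at most `n` elements each which disagree on some
formula of `∃⁺L^k` disagree on some formula `φ` of `∃⁺L^k` with
`quant φ ≤ n ^ (c * n^(2k-2))`. -/
theorem statement_9 (σ : Signature) (k : ℕ) (hk : 1 ≤ k) :
    ∃ c : ℝ, 0 < c ∧ ∀ n : ℕ, 2 ≤ n →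
      ∀ (𝔄 𝔅 : Set (Pebbled σ)) (Dm : Set ℕ),
        (∀ P ∈ 𝔄 ∪ 𝔅, P.dom = Dm) →
        (∀ P ∈ 𝔄 ∪ 𝔅, P.IsK k) →
        (∀ P ∈ 𝔄 ∪ 𝔅, Finite P.M.carrier ∧ Nat.card P.M.carrier ≤ n) →
        (∃ φ₀ : Fml σ, UsesVars k φ₀ ∧ Fml.ExPos φ₀ ∧
          (φ₀.freeVars : Set ℕ) ⊆ Dm ∧ DisagreeOn 𝔄 𝔅 φ₀) →
        ∃ φ : Fml σ, UsesVars k φ ∧ Fml.ExPos φ ∧ (φ.freeVars : Set ℕ) ⊆ Dm ∧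
          DisagreeOn 𝔄 𝔅 φ ∧
          (φ.quant : ℝ) ≤ (n : ℝ) ^ (c * (n : ℝ) ^ (2 * k - 2)) := by
  obtain ⟨e, he⟩ := lab_exists σ k hk
  refine ⟨((2 * e + k * 2 ^ (k - 1) + 1 : ℕ) : ℝ), by positivity, ?_⟩
  intro n hn 𝔄 𝔅 Dm hdom _ hcard ⟨φ₀, v0, x0, f0, hA0, hB0⟩
  obtain ⟨T, N, hfin, hN, hNle, hlab⟩ := he n hn
  let 𝔸 : Set (Pt σ) := {p | p = ⟨fullS σ, fun _ => ()⟩ ∨ ∃ P ∈ 𝔄, ∃ f : ℕ → P.M.carrier,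
    (∀ i a, P.α i = some a → f i = a) ∧ p = ⟨P.M, f⟩}
  let 𝔹 : Set (Pt σ) := {p | ∃ P ∈ 𝔅, ∃ f : ℕ → P.M.carrier,
    (∀ i a, P.α i = some a → f i = a) ∧ p = ⟨P.M, f⟩}
  have hc : ∀ p ∈ 𝔸 ∪ 𝔹, Finite p.1.carrier ∧ Nat.card p.1.carrier ≤ n := by
    rintro p ((rfl | ⟨P, hP, f, hf, rfl⟩) | ⟨P, hP, f, hf, rfl⟩)
    · have h1 : Finite Unit := inferInstance
      have h2 : Nat.card Unit ≤ n := by simp; omega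
      exact ⟨h1, h2⟩
    · exact hcard P (Or.inl hP)
    · exact hcard P (Or.inr hP)
  obtain ⟨φ, hφ, hq, hA, hB⟩ := core hk hn 𝔸 𝔹 Dm ⟨_, Or.inl rfl⟩ hc hN
    (fun p hp => hlab p.1 (hc p hp).1 (hc p hp).2) φ₀ ⟨v0, x0, f0⟩
    (by
      rintro p (rfl | ⟨P, hP, f, hf, rfl⟩)
      · exact full_sat φ₀ x0 _
      · exact hA0 P hP f hf)
    (by
      rintro p ⟨P, hP, f, hf, rfl⟩ hs
      refine hB0 P hP fun f' hf' => ?_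
      refine (sat_congr P.M φ₀ f f' fun i hi => ?_).1 hs
      have hi : i ∈ P.dom := by
        rw [hdom P (Or.inr hP)]
        exact f0 hi
      obtain ⟨a, ha⟩ := Option.ne_none_iff_exists'.1 hi
      rw [hf i a ha, hf' i a ha])
  refine ⟨φ, hφ.1, hφ.2.1, hφ.2.2, ⟨?_, ?_⟩, ?_⟩
  · intro P hP f hf
    exact hA ⟨P.M, f⟩ (Or.inr ⟨P, hP, f, hf, rfl⟩)
  · intro P hP hs
    refine hB0 P hP fun f hf => ?_
    exact (hB ⟨P.M, f⟩ ⟨P, hP, f, hf, rfl⟩ (hs f hf)).elim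
  · have hnat : φ.quant ≤ n ^ ((2 * e + k * 2 ^ (k - 1) + 1) * n ^ (2 * k - 2)) := by
      refine hq.trans ?_
      have h1 : 1 ≤ n ^ (2 * k - 2) := Nat.one_le_pow _ _ (by omega)
      calc _ ≤ (n ^ (e * n ^ (2 * k - 2))) ^ 2 *
            n ^ (k * 2 ^ (k - 1) * n ^ (2 * k - 2) + 1) :=
            Nat.mul_le_mul_right _ (Nat.pow_le_pow_left hNle 2)
        _ = n ^ (e * n ^ (2 * k - 2) * 2 + (k * 2 ^ (k - 1) * n ^ (2 * k - 2) + 1)) := by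
            rw [← pow_mul, ← pow_add]
        _ ≤ _ := Nat.pow_le_pow_right (by omega) (by nlinarith)
    have := (Nat.cast_le (α := ℝ)).2 hnat
    rw [Nat.cast_pow, ← Real.rpow_natCast] at this
    simpa only [Nat.cast_mul, Nat.cast_pow] using this


end QVT
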